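/- Let H be a Hilbert space, U : ℤ² → unitary operators on H a unitary representation of ℤ², f ∈ H, and let P, Q ⊆ ℤ² be such that the closures of {U(w) f : w ∈ P} and {U(w) f : w ∈ Q} are compact in H. Then the closure of {U(w) f : w ∈ P + Q} is compact in H, where P + Q is the Minkowski sum. -/

import Mathlib

/-- If a commutative additive semigroup acts by isometries on a pseudometric space and the partial
orbits of `x` along `P` and `Q` are totally bounded, so is the partial orbit along `P + Q`. -/
theorem totallyBounded_orbit_image_add {G X : Type*} [AddCommSemigroup G] [PseudoMetricSpace X]
    {T : G → X → X} (hT : ∀ g, Isometry (T g)) (hadd : ∀ g h x, T (g + h) x = T g (T h x))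
    {x : X} {P Q : Set G} (hP : TotallyBounded ((fun g => T g x) '' P))
    (hQ : TotallyBounded ((fun g => T g x) '' Q)) :
    TotallyBounded ((fun g => T g x) '' {g | ∃ p ∈ P, ∃ q ∈ Q, g = p + q}) := by
  have approx : ∀ {S : Set G}, TotallyBounded ((fun g => T g x) '' S) → ∀ ε > 0,
      ∃ A : Set G, A.Finite ∧ ∀ s ∈ S, ∃ a ∈ A, dist (T s x) (T a x) < ε := by
    intro S hS ε hε
    obtain ⟨t, htS, htfin, ht⟩ := Metric.finite_approx_of_totallyBounded hS ε hε
    obtain ⟨A, -, hAfin, rfl⟩ := htfin.exists_subset_finite_image_eq htS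
    refine ⟨A, hAfin, fun s hs => ?_⟩
    simpa using ht (Set.mem_image_of_mem _ hs)
  refine Metric.totallyBounded_iff.mpr fun ε hε => ?_
  obtain ⟨A, hA, hPA⟩ := approx hP (ε / 2) (half_pos hε)
  obtain ⟨B, hB, hQB⟩ := approx hQ (ε / 2) (half_pos hε)
  refine ⟨Set.image2 (fun a b => T (b + a) x) A B, hA.image2 _ hB, ?_⟩
  rintro _ ⟨_, ⟨p, hp, q, hq, rfl⟩, rfl⟩
  obtain ⟨a, ha, hpa⟩ := hPA p hp
  obtain ⟨b, hb, hqb⟩ := hQB q hq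
  refine Set.mem_biUnion (Set.mem_image2_of_mem ha hb) (Metric.mem_ball.mpr ?_)
  calc dist (T (p + q) x) (T (b + a) x)
      ≤ dist (T (p + q) x) (T (p + b) x) + dist (T (p + b) x) (T (b + a) x) :=
        dist_triangle _ _ _
    _ = dist (T q x) (T b x) + dist (T p x) (T a x) := by
        rw [hadd p q, hadd p b, (hT p).dist_eq, ← hadd p b, add_comm p b, hadd b p, hadd b a,
          (hT b).dist_eq]
    _ < ε := by linarith

theorem stmt5 {H : Type*} [NormedAddCommGroup H] [InnerProductSpace ℂ H] [CompleteSpace H]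
    (U : ℤ × ℤ → (H ≃ₗᵢ[ℂ] H)) (hU : ∀ v w : ℤ × ℤ, U (v + w) = (U w).trans (U v))
    (f : H) (P Q : Set (ℤ × ℤ))
    (hP : IsCompact (closure ((fun w => U w f) '' P)))
    (hQ : IsCompact (closure ((fun w => U w f) '' Q))) :
    IsCompact (closure ((fun w => U w f) ''
      {w : ℤ × ℤ | ∃ p ∈ P, ∃ q ∈ Q, w = p + q})) := by
  exact (totallyBounded_orbit_image_add (T := fun w => U w) (fun w => (U w).isometry)
    (fun v w x => by simp [hU]) (hP.totallyBounded.subset subset_closure)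
    (hQ.totallyBounded.subset subset_closure)).closure.isCompact_of_isClosed isClosed_closure
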